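/- arXiv:1207.2485 — 2 statements merged into one kernel-verified Lean document; each statement's English description precedes it below -/
import Mathlib

section
/- Let M ≥ 2 and r ≥ 2 be integers, let x be a real number with π/(2M) ≤ x < π/2, and set W = 1 + i·(x/r) − (x/r)². Then |sin x − Im(W^r)| ≤ 2^7 / r and |cos x − Re(W^r)| ≤ 2^7 / r. -/
open Real

/-- Powers of elements of the closed unit ball are Lipschitz with constant the exponent. -/
lemma norm_pow_sub_pow_le_of_norm_le_one {a b : ℂ} (ha : ‖a‖ ≤ 1) (hb : ‖b‖ ≤ 1) (n : ℕ) :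
    ‖a ^ n - b ^ n‖ ≤ n * ‖a - b‖ := by
  induction n with
  | zero => simp
  | succ n ih =>
    have h : a ^ (n + 1) - b ^ (n + 1) = a ^ n * (a - b) + (a ^ n - b ^ n) * b := by ring
    calc ‖a ^ (n + 1) - b ^ (n + 1)‖
        ≤ ‖a‖ ^ n * ‖a - b‖ + ‖a ^ n - b ^ n‖ * ‖b‖ := by
          rw [h, ← norm_pow, ← norm_mul, ← norm_mul]
          exact norm_add_le _ _
      _ ≤ 1 * ‖a - b‖ + n * ‖a - b‖ * 1 := by
          gcongr
          exact pow_le_one₀ (norm_nonneg a) ha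
      _ = (n + 1 : ℕ) * ‖a - b‖ := by push_cast; ring

lemma norm_one_add_I_mul_sub_sq_le_one {y : ℝ} (hy : |y| ≤ 1) :
    ‖1 + Complex.I * (y : ℂ) - (y : ℂ) ^ 2‖ ≤ 1 := by
  have h : 1 + Complex.I * (y : ℂ) - (y : ℂ) ^ 2 = ((1 - y ^ 2 : ℝ) : ℂ) + y * Complex.I := by
    push_cast; ring
  rw [h, Complex.norm_add_mul_I, Real.sqrt_le_iff]
  refine ⟨zero_le_one, ?_⟩
  nlinarith [(sq_le_one_iff_abs_le_one y).2 hy, sq_nonneg y]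

lemma norm_exp_mul_I_sub_le {y : ℝ} (hy : |y| ≤ 1) :
    ‖Complex.exp (y * Complex.I) - (1 + Complex.I * (y : ℂ) - (y : ℂ) ^ 2)‖ ≤ 2 * y ^ 2 := by
  have h := Complex.norm_exp_sub_one_sub_id_le (x := y * Complex.I) (by simpa using hy)
  have hI : ‖(y : ℂ) * Complex.I‖ = |y| := by simp
  rw [hI, sq_abs] at h
  have hsq : ‖(y : ℂ) ^ 2‖ = y ^ 2 := by simp
  calc _ = ‖(Complex.exp (y * Complex.I) - 1 - y * Complex.I) + (y : ℂ) ^ 2‖ := by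
        congr 1; ring
    _ ≤ _ := norm_add_le _ _
    _ ≤ 2 * y ^ 2 := by rw [hsq]; linarith

/-- For integers `M ≥ 2`, `r ≥ 2`, a real `x` with `π/(2M) ≤ x < π/2`, and
`W = 1 + i(x/r) - (x/r)²`, one has `|sin x - Im(W^r)| ≤ 2^7/r` and
`|cos x - Re(W^r)| ≤ 2^7/r`. -/
theorem sin_cos_repeated_squaring_approx (M r : ℕ) (hM : 2 ≤ M) (hr : 2 ≤ r)
    (x : ℝ) (hx1 : π / (2*M) ≤ x) (hx2 : x < π / 2) :
    |Real.sin x - ((1 + Complex.I * (x / r : ℝ) - ((x / r : ℝ) : ℂ)^2)^r).im|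
        ≤ 2^7 / r ∧
    |Real.cos x - ((1 + Complex.I * (x / r : ℝ) - ((x / r : ℝ) : ℂ)^2)^r).re|
        ≤ 2^7 / r := by
  have hx0 : 0 ≤ x := le_trans (by positivity) hx1
  have hx : x ≤ 2 := by linarith [Real.pi_le_four]
  have hr2 : (2 : ℝ) ≤ r := by exact_mod_cast hr
  have hr0 : (0 : ℝ) < r := by linarith
  have hy : |x / r| ≤ 1 := by
    rw [abs_of_nonneg (by positivity), div_le_one hr0]
    linarith
  have hexp : Complex.exp ((x / r : ℝ) * Complex.I) ^ r = Complex.exp (x * Complex.I) := by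
    have hrc : (r : ℂ) ≠ 0 := by exact_mod_cast hr0.ne'
    rw [← Complex.exp_nat_mul]
    congr 1
    push_cast
    field_simp
  have key : ‖Complex.exp (x * Complex.I)
      - (1 + Complex.I * (x / r : ℝ) - ((x / r : ℝ) : ℂ) ^ 2) ^ r‖ ≤ 2 ^ 7 / r := by
    rw [← hexp]
    calc _ ≤ _ := norm_pow_sub_pow_le_of_norm_le_one (Complex.norm_exp_ofReal_mul_I _).le
          (norm_one_add_I_mul_sub_sq_le_one hy) r
      _ ≤ r * (2 * (x / r) ^ 2) := by gcongr; exact norm_exp_mul_I_sub_le hy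
      _ = 2 * x ^ 2 / r := by field_simp
      _ ≤ 2 ^ 7 / r := by gcongr; nlinarith
  constructor
  · rw [← Complex.exp_ofReal_mul_I_im, ← Complex.sub_im]
    exact (Complex.abs_im_le_norm _).trans key
  · rw [← Complex.exp_ofReal_mul_I_re, ← Complex.sub_re]
    exact (Complex.abs_re_le_norm _).trans key
end

section
/- Fix integers ν ≥ 1, m ≥ 1, set M = 2^m, r = 2^{ν+7}, and s = max{2ν + 9, 11 + ν + m}. For each j = 1, …, M−1 let Ŵ_{r,j} be the fixed-precision repeated-squaring approximation (with s-bit truncations) of W_j^r, where W_j = 1 − (x_j/r)² + i·(x_j/r) and x_j = jπ/(2M). Then |4M²·sin²(jπ/(2M)) − 4M²·(Im(Ŵ_{r,j}))²| ≤ 2^{−(ν−4)}·M² for every j = 1, …, M−1. -/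
open Real

open Complex in
/-- Repeated squaring with a per-step error at most `η` inside the unit disc amplifies the distance
to the squares of `exp (i y)` by at most `2 ^ n`. -/
theorem norm_repeated_sq_sub_exp_le {W : ℕ → ℂ} {y η ε : ℝ} {N : ℕ}
    (h0 : ‖W 0 - exp (y * I)‖ ≤ ε) (hW0 : ‖W 0‖ ≤ 1)
    (hstep : ∀ i < N, ‖W (i + 1) - W i ^ 2‖ ≤ η)
    (hnorm : ∀ i < N, ‖W (i + 1)‖ ≤ ‖W i‖ ^ 2) :
    ∀ n ≤ N, ‖W n‖ ≤ 1 ∧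
      ‖W n - exp (((2 ^ n * y : ℝ) : ℂ) * I)‖ ≤ 2 ^ n * (ε + η) - η := by
  intro n
  induction n with
  | zero => intro _; exact ⟨hW0, by simpa using h0⟩
  | succ n ih =>
    intro hn
    obtain ⟨h1, h2⟩ := ih (by omega)
    refine ⟨(hnorm n hn).trans (pow_le_one₀ (norm_nonneg _) h1), ?_⟩
    set E := exp (((2 ^ n * y : ℝ) : ℂ) * I) with hE
    have hE1 : ‖E‖ = 1 := norm_exp_ofReal_mul_I _
    have hsq : exp (((2 ^ (n + 1) * y : ℝ) : ℂ) * I) = E ^ 2 := by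
      rw [hE, ← Complex.exp_nat_mul]
      congr 1
      push_cast
      ring
    have hsum : ‖W n + E‖ ≤ 2 := (norm_add_le _ _).trans (by linarith)
    calc ‖W (n + 1) - exp (((2 ^ (n + 1) * y : ℝ) : ℂ) * I)‖
        = ‖(W (n + 1) - W n ^ 2) + (W n + E) * (W n - E)‖ := by rw [hsq]; congr 1; ring
      _ ≤ ‖W (n + 1) - W n ^ 2‖ + ‖W n + E‖ * ‖W n - E‖ :=
          (norm_add_le _ _).trans (by rw [norm_mul])
      _ ≤ η + 2 * (2 ^ n * (ε + η) - η) := by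
          gcongr
          exact hstep n hn
      _ = 2 ^ (n + 1) * (ε + η) - η := by ring

open Complex in
theorem norm_one_sub_sq_add_mul_I_le_one {y : ℝ} (hy : |y| ≤ 1) :
    ‖1 - (y : ℂ) ^ 2 + y * I‖ ≤ 1 := by
  have hsq : y ^ 2 ≤ 1 := (sq_le_one_iff_abs_le_one y).2 hy
  have h : 1 - (y : ℂ) ^ 2 + y * I = ((1 - y ^ 2 : ℝ) : ℂ) + (y : ℝ) * I := by push_cast; ring
  rw [h, norm_add_mul_I]
  exact Real.sqrt_le_one.2 (by nlinarith [sq_nonneg y])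

open Complex in
theorem norm_one_sub_sq_add_mul_I_sub_exp_le {y : ℝ} (hy : |y| ≤ 1) :
    ‖1 - (y : ℂ) ^ 2 + y * I - exp (y * I)‖ ≤ 2 * y ^ 2 := by
  have hn : ‖(y : ℂ) * I‖ = |y| := by simp
  have h1 := norm_exp_sub_one_sub_id_le (x := (y : ℂ) * I) (by rwa [hn])
  rw [hn, sq_abs] at h1
  calc ‖1 - (y : ℂ) ^ 2 + y * I - exp (y * I)‖
      = ‖(y : ℂ) ^ 2 + (exp (y * I) - 1 - y * I)‖ := by rw [← norm_neg]; congr 1; ring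
    _ ≤ ‖(y : ℂ) ^ 2‖ + ‖exp (y * I) - 1 - y * I‖ := norm_add_le _ _
    _ ≤ 2 * y ^ 2 := by
      have : ‖(y : ℂ) ^ 2‖ = y ^ 2 := by simp
      linarith

open Complex in
theorem norm_one_sub_sq_add_mul_I_sub_le {y z : ℝ} (h : |y + z| ≤ 1) :
    ‖(1 - (z : ℂ) ^ 2 + z * I) - (1 - (y : ℂ) ^ 2 + y * I)‖ ≤ 2 * |y - z| := by
  have hfac : (1 - (z : ℂ) ^ 2 + z * I) - (1 - (y : ℂ) ^ 2 + y * I)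
      = ((y - z : ℝ) : ℂ) * (((y + z : ℝ) : ℂ) - I) := by push_cast; ring
  rw [hfac, norm_mul, norm_real, Real.norm_eq_abs, mul_comm]
  gcongr
  refine (norm_sub_le _ _).trans ?_
  rw [norm_real, Real.norm_eq_abs, norm_I]
  linarith

theorem abs_sq_sub_sq_le {a b c : ℝ} (ha : |a| ≤ 1) (hb : |b| ≤ 1) (h : |a - b| ≤ c) :
    |a ^ 2 - b ^ 2| ≤ 2 * c := by
  rw [sq_sub_sq, abs_mul]
  exact mul_le_mul ((abs_add_le a b).trans (by linarith)) h (abs_nonneg _) two_pos.le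

/-- Eigenvalue approximation of the discretized 1D Laplacian: with `ν ≥ 1`,
`m ≥ 1`, `M = 2^m`, `r = 2^{ν+7}`, `s = max(2ν+9, 11+ν+m)`, for each
`j = 1, …, M-1` let `x_j = jπ/(2M)`, `ŷ_j` the `s`-bit truncation of `x_j/r`,
and `Ŵ_{r,j} = Wh j (ν+7)` the result of `ν+7` fixed-precision
repeated-squaring steps (with `s`-bit truncations) starting from the `s`-bit
truncation `Wh j 0` of `1 - ŷ_j² + i·ŷ_j`. Then
`|4M²·sin²(jπ/(2M)) - 4M²·(Im Ŵ_{r,j})²| ≤ 2^{-(ν-4)}·M²`. -/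
theorem eigenvalue_fixed_precision_error
    (ν m : ℕ) (hν : 1 ≤ ν) (hm : 1 ≤ m) (s : ℕ)
    (hs : s = max (2*ν + 9) (11 + ν + m))
    (yh : ℕ → ℝ) (Wh : ℕ → ℕ → ℂ)
    (hy1 : ∀ j, 1 ≤ j → j ≤ 2^m - 1 →
      0 ≤ (j * π / (2 * 2^m)) / 2^(ν+7) - yh j)
    (hy2 : ∀ j, 1 ≤ j → j ≤ 2^m - 1 →
      (j * π / (2 * 2^m)) / 2^(ν+7) - yh j ≤ (2:ℝ)^(-(s:ℤ)))
    (h0re : ∀ j, 1 ≤ j → j ≤ 2^m - 1 →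
      |(Wh j 0 - (1 - (yh j : ℂ)^2 + (yh j : ℝ) * Complex.I)).re| ≤ (2:ℝ)^(-(s:ℤ)))
    (h0im : ∀ j, 1 ≤ j → j ≤ 2^m - 1 →
      |(Wh j 0 - (1 - (yh j : ℂ)^2 + (yh j : ℝ) * Complex.I)).im| ≤ (2:ℝ)^(-(s:ℤ)))
    (h0norm : ∀ j, 1 ≤ j → j ≤ 2^m - 1 →
      ‖Wh j 0‖ ≤ ‖1 - (yh j : ℂ)^2 + (yh j : ℝ) * Complex.I‖)
    (hstepre : ∀ j, 1 ≤ j → j ≤ 2^m - 1 → ∀ i < ν + 7,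
      |(Wh j (i+1) - (Wh j i)^2).re| ≤ (2:ℝ)^(-(s:ℤ)))
    (hstepim : ∀ j, 1 ≤ j → j ≤ 2^m - 1 → ∀ i < ν + 7,
      |(Wh j (i+1) - (Wh j i)^2).im| ≤ (2:ℝ)^(-(s:ℤ)))
    (hstepnorm : ∀ j, 1 ≤ j → j ≤ 2^m - 1 → ∀ i < ν + 7,
      ‖Wh j (i+1)‖ ≤ ‖Wh j i‖^2) :
    ∀ j : ℕ, 1 ≤ j → j ≤ 2^m - 1 →
      |4 * ((2:ℝ)^m)^2 * Real.sin (j * π / (2 * 2^m))^2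
          - 4 * ((2:ℝ)^m)^2 * ((Wh j (ν+7)).im)^2|
        ≤ (2:ℝ)^(-((ν:ℤ) - 4)) * ((2:ℝ)^m)^2 := by
  intro j hj1 hj2
  specialize hy1 j hj1 hj2
  specialize hy2 j hj1 hj2
  specialize h0re j hj1 hj2
  specialize h0im j hj1 hj2
  specialize h0norm j hj1 hj2
  specialize hstepre j hj1 hj2
  specialize hstepim j hj1 hj2
  specialize hstepnorm j hj1 hj2
  set x : ℝ := j * π / (2 * 2 ^ m)
  set δ : ℝ := (2 : ℝ) ^ (-(s : ℤ))
  set q : ℝ := (2 : ℝ)⁻¹ ^ ν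
  have hq0 : 0 < q := by positivity
  have hq1 : q ≤ 1 / 2 := by
    simpa [q] using pow_le_pow_of_le_one (a := (2 : ℝ)⁻¹) (by norm_num) (by norm_num) hν
  have hrq : (2 : ℝ) ^ (ν + 7) * q = 128 := by
    simp only [q, pow_add, inv_pow]
    field_simp
    norm_num
  have hδ0 : 0 < δ := by positivity
  have hδ : δ ≤ q ^ 2 / 512 := by
    have h1 : δ = (2 : ℝ)⁻¹ ^ s := by simp [δ]
    have h2 : q ^ 2 / 512 = (2 : ℝ)⁻¹ ^ (2 * ν + 9) := by
      simp only [q, pow_add, ← pow_mul, mul_comm ν 2]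
      norm_num
      ring
    rw [h1, h2]
    exact pow_le_pow_of_le_one (by norm_num) (by norm_num) (hs ▸ le_max_left _ _)
  have hx0 : 0 ≤ x := by positivity
  have hx : x ≤ 8 / 5 := by
    have hjm : (j : ℝ) ≤ 2 ^ m := by exact_mod_cast hj2.trans (Nat.sub_le _ _)
    have hπ : π ≤ 3.2 := by linarith [Real.pi_lt_d2]
    simp only [x]
    rw [div_le_iff₀ (by positivity)]
    nlinarith [Real.pi_pos, mul_le_mul hjm hπ Real.pi_pos.le (by positivity)]
  set y : ℝ := x / 2 ^ (ν + 7) with hy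
  have hyq : y = x * q / 128 := by
    rw [hy, ← hrq]
    field_simp
  have hy0 : 0 ≤ y := by positivity
  have hyle : y ≤ 1 / 80 * q := by rw [hyq]; nlinarith
  have hδle : δ ≤ 1 / 1024 := by nlinarith
  have hz0 : ‖Wh j 0‖ ≤ 1 := h0norm.trans <|
    norm_one_sub_sq_add_mul_I_le_one (abs_le.2 ⟨by linarith, by linarith⟩)
  have he0 : ‖Wh j 0 - Complex.exp (y * Complex.I)‖ ≤ 4 * δ + 2 * y ^ 2 := by
    have h1 := (Complex.norm_le_abs_re_add_abs_im _).trans (add_le_add h0re h0im)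
    have h2 := norm_one_sub_sq_add_mul_I_sub_le (y := y) (z := yh j)
      (abs_le.2 ⟨by linarith, by linarith⟩)
    have h3 := norm_one_sub_sq_add_mul_I_sub_exp_le (y := y) (abs_le.2 ⟨by linarith, by linarith⟩)
    rw [abs_of_nonneg hy1] at h2
    have h4 := norm_sub_le_norm_sub_add_norm_sub (Wh j 0)
      (1 - (yh j : ℂ) ^ 2 + (yh j : ℝ) * Complex.I) (Complex.exp (y * Complex.I))
    have h5 := norm_sub_le_norm_sub_add_norm_sub
      (1 - (yh j : ℂ) ^ 2 + (yh j : ℝ) * Complex.I) (1 - (y : ℂ) ^ 2 + y * Complex.I)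
      (Complex.exp (y * Complex.I))
    linarith
  obtain ⟨hWn, hWe⟩ := norm_repeated_sq_sub_exp_le (η := 2 * δ) he0 hz0
    (fun i hi => (Complex.norm_le_abs_re_add_abs_im _).trans
      ((add_le_add (hstepre i hi) (hstepim i hi)).trans_eq (two_mul δ).symm))
    hstepnorm (ν + 7) le_rfl
  have hxy : 2 ^ (ν + 7) * y = x := mul_div_cancel₀ _ (by positivity)
  rw [hxy] at hWe
  have herr : |sin x - (Wh j (ν + 7)).im| ≤ 2 * q := by
    have him : (Wh j (ν + 7) - Complex.exp (x * Complex.I)).im = (Wh j (ν + 7)).im - sin x := by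
      rw [Complex.sub_im, Complex.exp_ofReal_mul_I_im]
    rw [abs_sub_comm, ← him]
    refine (Complex.abs_im_le_norm _).trans (hWe.trans ?_)
    have hb : 4 * δ + 2 * y ^ 2 + 2 * δ ≤ q ^ 2 / 64 := by nlinarith
    calc 2 ^ (ν + 7) * (4 * δ + 2 * y ^ 2 + 2 * δ) - 2 * δ
        ≤ 2 ^ (ν + 7) * (q ^ 2 / 64) - 0 := by gcongr; positivity
      _ = (2 ^ (ν + 7) * q) * q / 64 := by ring
      _ = 2 * q := by rw [hrq]; ring
  have hfin := abs_sq_sub_sq_le (Real.abs_sin_le_one x)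
    ((Complex.abs_im_le_norm _).trans hWn) herr
  have hR : (2 : ℝ) ^ (-((ν : ℤ) - 4)) = 16 * q := by
    rw [neg_sub, zpow_sub₀ two_ne_zero, zpow_natCast, div_eq_mul_inv]
    simp only [q, inv_pow]
    norm_num
  rw [hR, ← mul_sub, abs_mul, abs_of_nonneg (by positivity)]
  nlinarith [sq_nonneg ((2 : ℝ) ^ m)]
end
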